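/- arXiv:2206.14423 — 6 statements merged into one kernel-verified Lean document; each statement's English description precedes it below -/
import Mathlib

section
/- Let v₁, v₂, v' be points in the Euclidean plane with v₂ ≠ v₁ and v' ≠ v₁, let θ = ∠ v₂ v₁ v' (the undirected angle at v₁) and assume θ < π. Let S be a set of points with v₁ ∈ S such that every s ∈ S can be written s = v₁ + a•(v₂ − v₁) + b•(v' − v₁) for some real numbers a ≥ 0 and b ≥ 0 (i.e., S lies in the convex cone at apex v₁ spanned by the two hull edges at v₁). If x is a point with x ≠ v₁ and ∠ x v₁ v₂ ≤ (π − θ)/4, then v₁ is an extreme point of the convex hull of S ∪ {x}. -/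
open EuclideanGeometry

section InnerProductSpace

variable {V : Type*} [NormedAddCommGroup V] [InnerProductSpace ℝ V]

/-- A point of `A` at which a linear functional attains its minimum over `A` strictly is an extreme
point of the convex hull of `A`. -/
theorem mem_extremePoints_convexHull_of_inner_lt {A : Set V} {p w : V} (hp : p ∈ A)
    (h : ∀ y ∈ A, y ≠ p → inner ℝ w p < inner ℝ w y) :
    p ∈ Set.extremePoints ℝ (convexHull ℝ A) := by
  have hconv : Convex ℝ {y : V | y = p ∨ inner ℝ w p < inner ℝ w y} := by
    rw [convex_iff_forall_pos]
    intro y hy z hz a b ha hb hab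
    have hsum : inner ℝ w (a • y + b • z) = a * inner ℝ w y + b * inner ℝ w z := by
      rw [inner_add_right, real_inner_smul_right, real_inner_smul_right]
    simp only [Set.mem_ofPred_eq, hsum]
    obtain rfl : b = 1 - a := by linarith
    rcases hy with rfl | hy <;> rcases hz with rfl | hz
    · left
      rw [← add_smul, hab, one_smul]
    all_goals
      right
      nlinarith
  have hsub : convexHull ℝ A ⊆ {y : V | y = p ∨ inner ℝ w p < inner ℝ w y} :=
    convexHull_min (fun y hy => or_iff_not_imp_left.2 (h y hy)) hconv
  rw [mem_extremePoints_iff_left]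
  refine ⟨subset_convexHull ℝ A hp, fun y hy z hz hyz => ?_⟩
  obtain ⟨a, b, ha, hb, hab, hp'⟩ := hyz
  have hsum : a * inner ℝ w y + b * inner ℝ w z = inner ℝ w p := by
    rw [← hp', inner_add_right, real_inner_smul_right, real_inner_smul_right]
  have hz' : inner ℝ w p ≤ inner ℝ w z := by
    rcases hsub hz with rfl | hz
    exacts [le_rfl, hz.le]
  refine (hsub hy).resolve_right fun hy' => ?_
  obtain rfl : b = 1 - a := by linarith
  nlinarith [mul_pos ha (sub_pos.2 hy'), mul_nonneg hb.le (sub_nonneg.2 hz')]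

/-- The angle between two nonzero vectors has a bisector (the zero vector if they are opposite). -/
theorem exists_angle_eq_half_angle {p q : V} (hp : p ≠ 0) (hq : q ≠ 0) :
    ∃ w : V, InnerProductGeometry.angle p w = InnerProductGeometry.angle p q / 2 ∧
      InnerProductGeometry.angle w q = InnerProductGeometry.angle p q / 2 := by
  have hp' : 0 < ‖p‖⁻¹ := inv_pos.2 (norm_pos_iff.2 hp)
  have hq' : 0 < ‖q‖⁻¹ := inv_pos.2 (norm_pos_iff.2 hq)
  set u := ‖p‖⁻¹ • p
  set v := ‖q‖⁻¹ • q
  have hnu : ‖u‖ = 1 := norm_smul_inv_norm (𝕜 := ℝ) hp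
  have hnv : ‖v‖ = 1 := norm_smul_inv_norm (𝕜 := ℝ) hq
  have hpu (z : V) : InnerProductGeometry.angle u z = InnerProductGeometry.angle p z :=
    InnerProductGeometry.angle_smul_left_of_pos _ _ hp'
  have hqv (z : V) : InnerProductGeometry.angle z v = InnerProductGeometry.angle z q :=
    InnerProductGeometry.angle_smul_right_of_pos _ _ hq'
  have hsymm : InnerProductGeometry.angle u (u + v) = InnerProductGeometry.angle v (u + v) := by
    simp only [InnerProductGeometry.angle, inner_add_right, hnu, hnv,
      real_inner_self_eq_norm_sq, real_inner_comm u v]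
    rw [add_comm]
  have hadd := InnerProductGeometry.angle_eq_angle_add_add_angle_add u
    (norm_ne_zero_iff.1 (hnv ▸ one_ne_zero))
  rw [InnerProductGeometry.angle_comm v, hqv, hqv, hpu, hpu] at hadd
  rw [InnerProductGeometry.angle_comm v, hqv, hpu] at hsymm
  exact ⟨u + v, by linarith, by linarith⟩

theorem inner_pos_of_angle_lt_pi_div_two {x y : V}
    (h : InnerProductGeometry.angle x y < Real.pi / 2) : 0 < inner ℝ x y := by
  rw [InnerProductGeometry.angle, Real.arccos_lt_pi_div_two] at h
  exact pos_of_mul_pos_left h (inv_nonneg.2 (by positivity))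

end InnerProductSpace

theorem corner_stays_extreme_one_safe_zone
    (v₁ v₂ v' : EuclideanSpace ℝ (Fin 2))
    (hv₂ : v₂ ≠ v₁) (hv' : v' ≠ v₁)
    (hθ : ∠ v₂ v₁ v' < Real.pi)
    (S : Set (EuclideanSpace ℝ (Fin 2))) (hv₁S : v₁ ∈ S)
    (hS : ∀ s ∈ S, ∃ a b : ℝ, 0 ≤ a ∧ 0 ≤ b ∧
      s = v₁ + a • (v₂ - v₁) + b • (v' - v₁))
    (x : EuclideanSpace ℝ (Fin 2)) (hx : x ≠ v₁)
    (hxangle : ∠ x v₁ v₂ ≤ (Real.pi - ∠ v₂ v₁ v') / 4) :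
    v₁ ∈ Set.extremePoints ℝ (convexHull ℝ (S ∪ {x})) := by
  simp only [EuclideanGeometry.angle, vsub_eq_sub] at hθ hxangle
  obtain ⟨w, hpw, hwq⟩ := exists_angle_eq_half_angle (sub_ne_zero.2 hv₂) (sub_ne_zero.2 hv')
  have hp : 0 < inner ℝ w (v₂ - v₁) := by
    rw [real_inner_comm]
    exact inner_pos_of_angle_lt_pi_div_two (by linarith)
  have hq : 0 < inner ℝ w (v' - v₁) := inner_pos_of_angle_lt_pi_div_two (by linarith)
  have hr : 0 < inner ℝ w (x - v₁) := by
    rw [real_inner_comm]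
    have := InnerProductGeometry.angle_le_angle_add_angle (x - v₁) (v₂ - v₁) w
    exact inner_pos_of_angle_lt_pi_div_two (by linarith)
  refine mem_extremePoints_convexHull_of_inner_lt (w := w) (Or.inl hv₁S) ?_
  rintro y (hy | rfl) hne
  · obtain ⟨a, b, ha, hb, rfl⟩ := hS y hy
    rw [inner_add_right, inner_add_right, real_inner_smul_right, real_inner_smul_right]
    rcases ha.eq_or_lt with rfl | ha'
    · rcases hb.eq_or_lt with rfl | hb'
      · simp at hne
      · nlinarith [mul_pos hb' hq]
    · nlinarith [mul_pos ha' hp, mul_nonneg hb hq.le]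
  · rwa [inner_sub_right, sub_pos] at hr
end

section
/- Let v₁, v₂, v' be points in the Euclidean plane with v₂ ≠ v₁ and v' ≠ v₁, let θ = ∠ v₂ v₁ v' (the undirected angle at v₁) and assume θ < π. Let S be a set of points with v₁ ∈ S such that every s ∈ S can be written s = v₁ + a•(v₂ − v₁) + b•(v' − v₁) for some real numbers a ≥ 0 and b ≥ 0. Let X be a set of points such that every x ∈ X satisfies x ≠ v₁ and either ∠ x v₁ v₂ ≤ (π − θ)/4 or ∠ x v₁ v' ≤ (π − θ)/4. Then v₁ is an extreme point of the convex hull of S ∪ X. -/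
open EuclideanGeometry

namespace InnerProductGeometry

variable {V : Type*} [NormedAddCommGroup V] [InnerProductSpace ℝ V]

theorem inner_pos_of_angle_lt_pi_div_two {x y : V} (hx : x ≠ 0) (hy : y ≠ 0)
    (h : angle x y < Real.pi / 2) : 0 < inner ℝ x y := by
  rw [← cos_angle_mul_norm_mul_norm]
  have hcos : 0 < Real.cos (angle x y) :=
    Real.cos_pos_of_mem_Ioo ⟨by linarith [angle_nonneg x y, Real.pi_pos], h⟩
  have := norm_pos_iff.2 hx
  have := norm_pos_iff.2 hy
  positivity

theorem bisector_ne_zero {p q : V} (hp : p ≠ 0) (hq : q ≠ 0) (h : angle p q ≠ Real.pi) :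
    ‖q‖ • p + ‖p‖ • q ≠ 0 := by
  intro h0
  have hinner : inner ℝ p (‖q‖ • p + ‖p‖ • q) = 0 := by rw [h0, inner_zero_right]
  rw [inner_add_right, real_inner_smul_right, real_inner_smul_right,
    real_inner_self_eq_norm_sq] at hinner
  refine h ((inner_eq_neg_mul_norm_iff_angle_eq_pi hp hq).1 ?_)
  refine mul_left_cancel₀ (norm_ne_zero_iff.2 hp) ?_
  linear_combination hinner

theorem angle_bisector_eq {p q : V} (hp : p ≠ 0) (hq : q ≠ 0) :
    angle p (‖q‖ • p + ‖p‖ • q) = angle (‖q‖ • p + ‖p‖ • q) q := by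
  have hp' := norm_ne_zero_iff.2 hp
  have hq' := norm_ne_zero_iff.2 hq
  rw [angle_comm _ q, angle, angle, ← div_div, ← div_div]
  congr 2
  rw [div_eq_div_iff hp' hq', inner_add_right, inner_add_right, real_inner_smul_right,
    real_inner_smul_right, real_inner_smul_right, real_inner_smul_right,
    real_inner_self_eq_norm_sq, real_inner_self_eq_norm_sq, real_inner_comm p q]
  ring

/-- Two nonzero vectors that are not opposite have a vector bisecting the angle between them. -/
theorem exists_angle_eq_half {p q : V} (hp : p ≠ 0) (hq : q ≠ 0) (h : angle p q ≠ Real.pi) :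
    ∃ u : V, u ≠ 0 ∧ angle p u = angle p q / 2 ∧ angle q u = angle p q / 2 := by
  refine ⟨‖q‖ • p + ‖p‖ • q, bisector_ne_zero hp hq h, ?_⟩
  have hsum := angle_eq_angle_add_add_angle_add_of_mem_span (bisector_ne_zero hp hq h)
    (Submodule.mem_span_pair.2 ⟨‖q‖₊, ‖p‖₊, rfl⟩)
  have heq := angle_bisector_eq hp hq
  rw [angle_comm q]
  constructor <;> linarith

end InnerProductGeometry

/-- If every point of `A` other than `v` lies strictly on the positive side of a line through
`v ∈ A`, then `v` is an extreme point of the convex hull of `A`. -/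
theorem mem_extremePoints_convexHull_of_inner_pos {V : Type*} [NormedAddCommGroup V]
    [InnerProductSpace ℝ V] {A : Set V} {u v : V} (hv : v ∈ A)
    (hA : ∀ x ∈ A, x = v ∨ 0 < inner ℝ (x - v) u) :
    v ∈ Set.extremePoints ℝ (convexHull ℝ A) := by
  have key (y z : V) (a b : ℝ) (hab : a + b = 1) :
      inner ℝ (a • y + b • z - v) u = a * inner ℝ (y - v) u + b * inner ℝ (z - v) u := by
    rw [← real_inner_smul_left, ← real_inner_smul_left, ← inner_add_left]
    congr 1
    rw [smul_sub, smul_sub, sub_add_sub_comm, ← add_smul, hab, one_smul]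
  have hnonneg (y : V) (hy : y = v ∨ 0 < inner ℝ (y - v) u) : 0 ≤ inner ℝ (y - v) u := by
    rcases hy with rfl | hy
    · simp
    · exact hy.le
  have hconv : Convex ℝ {x : V | x = v ∨ 0 < inner ℝ (x - v) u} := by
    refine convex_iff_forall_pos.2 fun y hy z hz a b ha hb hab => ?_
    rw [Set.mem_ofPred_eq, key y z a b hab]
    have hy0 := hnonneg y hy
    have hz0 := hnonneg z hz
    rcases hy with rfl | hy
    · rcases hz with rfl | hz
      · left
        rw [← add_smul, hab, one_smul]
      · right
        positivity
    · right
      positivity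
  have hsub := convexHull_min (s := A) hA hconv
  refine mem_extremePoints_iff_left.2 ⟨subset_convexHull ℝ A hv, fun y hy z hz hvyz => ?_⟩
  obtain ⟨a, b, ha, hb, hab, hsum⟩ := hvyz
  have h0 := key y z a b hab
  rw [hsum, sub_self, inner_zero_left] at h0
  have hz0 := hnonneg z (hsub hz)
  refine (hsub hy).resolve_right fun hpos => ?_
  have : 0 < a * inner ℝ (y - v) u + b * inner ℝ (z - v) u := by positivity
  linarith

theorem corner_stays_extreme_two_safe_zones
    (v₁ v₂ v' : EuclideanSpace ℝ (Fin 2))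
    (hv₂ : v₂ ≠ v₁) (hv' : v' ≠ v₁)
    (hθ : ∠ v₂ v₁ v' < Real.pi)
    (S : Set (EuclideanSpace ℝ (Fin 2))) (hv₁S : v₁ ∈ S)
    (hS : ∀ s ∈ S, ∃ a b : ℝ, 0 ≤ a ∧ 0 ≤ b ∧
      s = v₁ + a • (v₂ - v₁) + b • (v' - v₁))
    (X : Set (EuclideanSpace ℝ (Fin 2)))
    (hX : ∀ x ∈ X, x ≠ v₁ ∧
      (∠ x v₁ v₂ ≤ (Real.pi - ∠ v₂ v₁ v') / 4 ∨
       ∠ x v₁ v' ≤ (Real.pi - ∠ v₂ v₁ v') / 4)) :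
    v₁ ∈ Set.extremePoints ℝ (convexHull ℝ (S ∪ X)) := by
  simp only [EuclideanGeometry.angle, vsub_eq_sub] at hθ hX
  have hp := sub_ne_zero.2 hv₂
  have hq := sub_ne_zero.2 hv'
  obtain ⟨u, hu, hpu, hqu⟩ := InnerProductGeometry.exists_angle_eq_half hp hq hθ.ne
  refine mem_extremePoints_convexHull_of_inner_pos (u := u) (Or.inl hv₁S) ?_
  rintro x (hx | hx)
  · have hp_pos := InnerProductGeometry.inner_pos_of_angle_lt_pi_div_two hp hu (by linarith)
    have hq_pos := InnerProductGeometry.inner_pos_of_angle_lt_pi_div_two hq hu (by linarith)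
    obtain ⟨a, b, ha, hb, rfl⟩ := hS x hx
    rw [add_assoc, add_sub_cancel_left, inner_add_left, real_inner_smul_left,
      real_inner_smul_left]
    rcases ha.eq_or_lt with rfl | ha
    · rcases hb.eq_or_lt with rfl | hb
      · left
        simp
      · right
        positivity
    · right
      positivity
  · obtain ⟨hne, hangle⟩ := hX x hx
    refine Or.inr (InnerProductGeometry.inner_pos_of_angle_lt_pi_div_two
      (sub_ne_zero.2 hne) hu ?_)
    rcases hangle with h | h
    · linarith [InnerProductGeometry.angle_le_angle_add_angle (x - v₁) (v₂ - v₁) u]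
    · linarith [InnerProductGeometry.angle_le_angle_add_angle (x - v₁) (v' - v₁) u]
end

section
/- Let v₁ ≠ v₂ be points in the Euclidean plane, let p ∈ openSegment ℝ v₁ v₂, and let x and w be points lying strictly on opposite sides of the line through v₁ and v₂ (i.e., x and w are strictly on opposite sides of the affine span of {v₁, v₂}). Then p lies in the topological interior of convexHull ℝ {v₁, v₂, x, w}. -/
theorem LinearMap.eq_of_mem_openSegment_of_le {E : Type*} [AddCommGroup E] [Module ℝ E]
    (f : E →ₗ[ℝ] ℝ) {a b p : E} (hp : p ∈ openSegment ℝ a b) (ha : f a ≤ f p) (hb : f b ≤ f p) :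
    f a = f p ∧ f b = f p := by
  obtain ⟨s, t, hs, ht, hst, rfl⟩ := hp
  obtain rfl : t = 1 - s := by linarith
  simp only [map_add, map_smul, smul_eq_mul] at ha hb ⊢
  have hab : f a ≤ f b := le_of_mul_le_mul_left (by linarith) ht
  have hba : f b ≤ f a := le_of_mul_le_mul_left (by linarith) hs
  rw [le_antisymm hab hba]
  constructor <;> ring

theorem affineSpan_insert_pair_eq_top {E : Type*} [AddCommGroup E] [Module ℝ E]
    [FiniteDimensional ℝ E] (hE : Module.finrank ℝ E = 2) {a b c : E} (hab : a ≠ b)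
    (hc : c ∉ affineSpan ℝ {a, b}) : affineSpan ℝ {a, b, c} = ⊤ := by
  have hind : AffineIndependent ℝ ![a, b, c] :=
    affineIndependent_of_ne_of_mem_of_mem_of_notMem hab
      (left_mem_affineSpan_pair ℝ a b) (right_mem_affineSpan_pair ℝ a b) hc
  have htop := hind.affineSpan_eq_top_iff_card_eq_finrank_add_one.2 (by simp [hE])
  rwa [Matrix.range_cons, Matrix.range_cons, Matrix.range_cons, Matrix.range_empty,
    Set.union_empty, Set.singleton_union, Set.singleton_union] at htop

theorem side_robot_becomes_interior
    (v₁ v₂ x w p : EuclideanSpace ℝ (Fin 2))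
    (hne : v₁ ≠ v₂)
    (hp : p ∈ openSegment ℝ v₁ v₂)
    (hxw : (affineSpan ℝ ({v₁, v₂} : Set (EuclideanSpace ℝ (Fin 2)))).SOppSide x w) :
    p ∈ interior (convexHull ℝ ({v₁, v₂, x, w} : Set (EuclideanSpace ℝ (Fin 2)))) := by
  set S : Set (EuclideanSpace ℝ (Fin 2)) := {v₁, v₂, x, w} with hS
  have hconv : Convex ℝ (convexHull ℝ S) := convex_convexHull ℝ S
  have hnonempty : (interior (convexHull ℝ S)).Nonempty := by
    rw [interior_convexHull_nonempty_iff_affineSpan_eq_top, ← top_le_iff,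
      ← affineSpan_insert_pair_eq_top (by simp) hne hxw.left_notMem]
    exact affineSpan_mono ℝ (by simp [hS, Set.insert_subset_iff])
  by_contra hpC
  obtain ⟨f, hf⟩ := geometric_hahn_banach_open_point hconv.interior isOpen_interior hpC
  have hle : ∀ y ∈ S, f y ≤ f p := fun y hy ↦
    closure_minimal (fun a ha ↦ (hf a ha).le) (isClosed_le f.continuous continuous_const)
      (hconv.closure_interior_eq_closure_of_nonempty_interior hnonempty ▸
        subset_closure (subset_convexHull ℝ S hy))
  obtain ⟨h₁, h₂⟩ := f.toLinearMap.eq_of_mem_openSegment_of_le hp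
    (hle v₁ (by simp [hS])) (hle v₂ (by simp [hS]))
  obtain ⟨z, hz, hxzw⟩ := hxw.exists_sbtw
  have hfz : f z = f p := by
    obtain ⟨r, rfl⟩ := mem_affineSpan_pair_iff_exists_lineMap_eq.1 hz
    have h₁' : f v₁ = f p := h₁
    have h₂' : f v₂ = f p := h₂
    simp [AffineMap.lineMap_apply, h₁', h₂']
  obtain ⟨h₃, h₄⟩ := f.toLinearMap.eq_of_mem_openSegment_of_le
    (mem_openSegment_of_ne_left_right hxzw.left_ne hxzw.right_ne (mem_segment_iff_wbtw.2 hxzw.wbtw))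
    ((hle x (by simp [hS])).trans_eq hfz.symm) ((hle w (by simp [hS])).trans_eq hfz.symm)
  obtain ⟨c, hc⟩ := hnonempty
  have hsub : S ⊆ {y | f p ≤ f y} := by
    rintro y (rfl | rfl | rfl | rfl)
    exacts [h₁.ge, h₂.ge, hfz.ge.trans h₃.ge, hfz.ge.trans h₄.ge]
  exact (hf c hc).not_ge
    (convexHull_min hsub (convex_halfSpace_ge f.toLinearMap.isLinear _) (interior_subset hc))
end

section
/- Let S be a finite set of points in the Euclidean plane, let E = Set.extremePoints ℝ (convexHull ℝ S), let p ∈ S with p ∈ E, and suppose the set S \ E of non-extreme points of S is nonempty. Then there exists q ∈ S \ E such that no point of S lies in openSegment ℝ p q. -/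
/-- A point strictly between two distinct points `p` and `q` is closer to `p` than `q` is. -/
theorem dist_lt_dist_of_mem_openSegment {V : Type*} [NormedAddCommGroup V] [NormedSpace ℝ V]
    {p q r : V} (hpq : p ≠ q) (hr : r ∈ openSegment ℝ p q) : dist p r < dist p q := by
  rw [openSegment_eq_image_lineMap] at hr
  obtain ⟨t, ⟨ht₀, ht₁⟩, rfl⟩ := hr
  rw [dist_left_lineMap, Real.norm_of_nonneg ht₀.le]
  exact mul_lt_of_lt_one_left (dist_pos.2 hpq) ht₁

theorem corner_sees_some_interior_robot
    (S : Set (EuclideanSpace ℝ (Fin 2))) (hfin : S.Finite)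
    (p : EuclideanSpace ℝ (Fin 2)) (hpS : p ∈ S)
    (hpE : p ∈ Set.extremePoints ℝ (convexHull ℝ S))
    (hne : (S \ Set.extremePoints ℝ (convexHull ℝ S)).Nonempty) :
    ∃ q ∈ S \ Set.extremePoints ℝ (convexHull ℝ S),
      ∀ r ∈ S, r ∉ openSegment ℝ p q := by
  obtain ⟨q, hq, hmin⟩ := Set.exists_min_image _ (dist p) hfin.sdiff hne
  have hpq : p ≠ q := fun h => hq.2 (h ▸ hpE)
  refine ⟨q, hq, fun r hrS hr => ?_⟩
  have hrE : r ∉ Set.extremePoints ℝ (convexHull ℝ S) := fun hrE => by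
    have hpr : p = r :=
      hrE.2 (subset_convexHull ℝ S hpS) (subset_convexHull ℝ S hq.1) hr
    rw [← hpr] at hr
    exact hpq (left_mem_openSegment_iff.1 hr)
  exact (hmin r ⟨hrS, hrE⟩).not_gt (dist_lt_dist_of_mem_openSegment hpq hr)
end

section
/- Let n ≥ 3 and let p : Fin n → EuclideanSpace ℝ 2 list the vertices of a strictly convex polygon in counterclockwise order, with indices taken modulo n; that is, for all i and j with j ≠ i and j ≠ i + 1, the cross product ((p (i+1)).1 − (p i).1) * ((p j).2 − (p i).2) − ((p (i+1)).2 − (p i).2) * ((p j).1 − (p i).1) is strictly positive (writing (·).1, (·).2 for the two coordinates). For each i set w i = ‖p (i+1) − p i‖⁻¹ • (p (i+1) − p i) + ‖p (i−1) − p i‖⁻¹ • (p (i−1) − p i) and q i = p i − ‖w i‖⁻¹ • (w i). Then for every i, w i ≠ 0 (so q i is well defined) and q i is an extreme point of convexHull ℝ (Set.range q). -/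
/-- If a linear functional is strictly larger at `x` than at every other point of `s`, then `x` is
an extreme point of the convex hull of `s`. -/
theorem mem_extremePoints_convexHull_of_forall_lt {E : Type*} [NormedAddCommGroup E]
    [NormedSpace ℝ E] {s : Set E} {x : E} (hx : x ∈ s) (f : StrongDual ℝ E)
    (hf : ∀ y ∈ s, y ≠ x → f y < f x) : x ∈ (convexHull ℝ s).extremePoints ℝ := by
  have hconvex : Convex ℝ {y | f y ≤ f x ∧ (f x ≤ f y → y = x)} := by
    rintro y ⟨hy, hyx⟩ z ⟨hz, hzx⟩ a b ha hb hab
    simp only [Set.mem_ofPred_eq, map_add, map_smul, smul_eq_mul]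
    obtain rfl : b = 1 - a := by linarith
    refine ⟨by nlinarith, fun h => ?_⟩
    rcases ha.eq_or_lt with rfl | ha
    · simpa using hzx (by linarith)
    rcases hb.eq_or_lt with hb | hb
    · simpa [show a = 1 by linarith] using hyx (by nlinarith)
    rw [hyx (by nlinarith), hzx (by nlinarith), ← add_smul, hab, one_smul]
  have hsub : convexHull ℝ s ⊆ {y | f y ≤ f x ∧ (f x ≤ f y → y = x)} := by
    refine convexHull_min (fun y hy => ?_) hconvex
    by_cases hyx : y = x
    · subst hyx
      exact ⟨le_rfl, fun _ => rfl⟩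
    · exact ⟨(hf y hy hyx).le, fun h => absurd h (hf y hy hyx).not_ge⟩
  exact exposedPoints_subset_extremePoints ⟨subset_convexHull ℝ s hx, f, fun y hy => hsub hy⟩

/-- The bisector of a positively oriented convex angle spanned by `a` and `b` makes an acute angle
with every nonzero vector `d` of the angle. -/
theorem inner_bisector_pos {a b d : EuclideanSpace ℝ (Fin 2)}
    (hab : 0 < a 0 * b 1 - a 1 * b 0) (had : 0 ≤ a 0 * d 1 - a 1 * d 0)
    (hdb : 0 ≤ d 0 * b 1 - d 1 * b 0)
    (hd : 0 < (a 0 * d 1 - a 1 * d 0) + (d 0 * b 1 - d 1 * b 0)) :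
    0 < inner ℝ (‖a‖⁻¹ • a + ‖b‖⁻¹ • b) d := by
  have ha : 0 < ‖a‖ := norm_pos_iff.2 (by rintro rfl; simp at hab)
  have hb : 0 < ‖b‖ := norm_pos_iff.2 (by rintro rfl; simp at hab)
  have ha2 : ‖a‖ ^ 2 = a 0 ^ 2 + a 1 ^ 2 := by
    simp [EuclideanSpace.real_norm_sq_eq, Fin.sum_univ_two]
  have hb2 : ‖b‖ ^ 2 = b 0 ^ 2 + b 1 ^ 2 := by
    simp [EuclideanSpace.real_norm_sq_eq, Fin.sum_univ_two]
  have hinner : inner ℝ (‖a‖⁻¹ • a + ‖b‖⁻¹ • b) d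
      = ‖a‖⁻¹ * (a 0 * d 0 + a 1 * d 1) + ‖b‖⁻¹ * (b 0 * d 0 + b 1 * d 1) := by
    simp [PiLp.inner_apply, Fin.sum_univ_two]
    ring
  rw [hinner]
  generalize ‖a‖ = r at *
  generalize ‖b‖ = s at *
  generalize a 0 = a₀ at *
  generalize a 1 = a₁ at *
  generalize b 0 = b₀ at *
  generalize b 1 = b₁ at *
  generalize d 0 = d₀ at *
  generalize d 1 = d₁ at *
  have hangle : 0 < r * s + (a₀ * b₀ + a₁ * b₁) := by
    have h : (a₀ * b₀ + a₁ * b₁) ^ 2 < (r * s) ^ 2 := by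
      rw [mul_pow, ha2, hb2]
      nlinarith [pow_pos hab 2]
    linarith [(abs_lt.1 (abs_lt_of_sq_lt_sq h (by positivity))).1]
  have hcoef : 0 < (d₀ * b₁ - d₁ * b₀) * r + (a₀ * d₁ - a₁ * d₀) * s := by
    rcases had.eq_or_lt with h | h
    · rw [← h] at hd ⊢
      nlinarith
    · positivity
  have hprod : (a₀ * b₁ - a₁ * b₀) * (s * (a₀ * d₀ + a₁ * d₁) + r * (b₀ * d₀ + b₁ * d₁))
      = ((d₀ * b₁ - d₁ * b₀) * r + (a₀ * d₁ - a₁ * d₀) * s) * (r * s + (a₀ * b₀ + a₁ * b₁)) := by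
    linear_combination (-(d₀ * b₁ - d₁ * b₀) * s) * ha2 - (a₀ * d₁ - a₁ * d₀) * r * hb2
  have hpos := pos_of_mul_pos_right (hprod ▸ mul_pos hcoef hangle) hab.le
  have hscale : r⁻¹ * (a₀ * d₀ + a₁ * d₁) + s⁻¹ * (b₀ * d₀ + b₁ * d₁)
      = (s * (a₀ * d₀ + a₁ * d₁) + r * (b₀ * d₀ + b₁ * d₁)) / (r * s) := by
    field_simp
  rw [hscale]
  positivity


theorem expanded_corners_stay_corners
    (n : ℕ) [NeZero n] (hn : 3 ≤ n)
    (p : Fin n → EuclideanSpace ℝ (Fin 2))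
    (hconv : ∀ i j : Fin n, j ≠ i → j ≠ i + 1 →
      0 < (p (i + 1) 0 - p i 0) * (p j 1 - p i 1)
          - (p (i + 1) 1 - p i 1) * (p j 0 - p i 0))
    (w : Fin n → EuclideanSpace ℝ (Fin 2))
    (hw : ∀ i, w i = ‖p (i + 1) - p i‖⁻¹ • (p (i + 1) - p i)
                     + ‖p (i - 1) - p i‖⁻¹ • (p (i - 1) - p i))
    (q : Fin n → EuclideanSpace ℝ (Fin 2))
    (hq : ∀ i, q i = p i - ‖w i‖⁻¹ • (w i)) :
    ∀ i, w i ≠ 0 ∧ q i ∈ Set.extremePoints ℝ (convexHull ℝ (Set.range q)) := by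
  have h1 : (1 : Fin n) ≠ 0 := by
    rw [Ne, Fin.ext_iff, Fin.val_one', Fin.val_zero, Nat.mod_eq_of_lt (by omega)]
    omega
  have h2 : (1 : Fin n) + 1 ≠ 0 := by
    rw [Ne, Fin.ext_iff, Fin.val_add, Fin.val_one', Fin.val_zero, Nat.mod_eq_of_lt (a := 1)
      (by omega), Nat.mod_eq_of_lt (by omega)]
    omega
  have hsucc (i : Fin n) : i + 1 ≠ i := by simpa using h1
  have hpred (i : Fin n) : i - 1 ≠ i := by simpa using h1
  have hpred_succ (i : Fin n) : i - 1 ≠ i + 1 := by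
    intro h
    apply h2
    have h' : i + (1 + 1) = i := by rw [← add_assoc, ← h, sub_add_cancel]
    simpa using h'
  have key (i j : Fin n) (hj : j ≠ i) : 0 < inner ℝ (w i) (p j - p i) := by
    have hnext (k : Fin n) (hk : k ≠ i) (hk' : k ≠ i + 1) := hconv i k hk hk'
    have hprev (k : Fin n) (hk : k ≠ i - 1) (hk' : k ≠ i) :=
      hconv (i - 1) k hk (by rwa [sub_add_cancel])
    simp only [sub_add_cancel] at hprev
    have hcorner := hnext (i - 1) (hpred i) (hpred_succ i)
    rw [hw]
    by_cases hjn : j = i + 1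
    · subst hjn
      apply inner_bisector_pos <;> simp only [PiLp.sub_apply] <;> linarith
    by_cases hjp : j = i - 1
    · subst hjp
      apply inner_bisector_pos <;> simp only [PiLp.sub_apply] <;> linarith
    have hjnext := hnext j hj hjn
    have hjprev := hprev j hjp hj
    apply inner_bisector_pos <;> simp only [PiLp.sub_apply] <;> linarith
  have hw0 (i : Fin n) : w i ≠ 0 := by
    intro h
    simpa [h] using key i (i + 1) (hsucc i)
  have hunit (i : Fin n) : ‖‖w i‖⁻¹ • w i‖ = 1 := norm_smul_inv_norm (𝕜 := ℝ) (hw0 i)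
  refine fun i => ⟨hw0 i, mem_extremePoints_convexHull_of_forall_lt (Set.mem_range_self i)
    (innerSL ℝ (-(‖w i‖⁻¹ • w i))) ?_⟩
  rintro _ ⟨j, rfl⟩ hji
  have hj : j ≠ i := fun h => hji (h ▸ rfl)
  have hpos : 0 < inner ℝ (‖w i‖⁻¹ • w i) (p j - p i) := by
    rw [real_inner_smul_left]
    exact mul_pos (inv_pos.2 (norm_pos_iff.2 (hw0 i))) (key i j hj)
  have hself : inner ℝ (‖w i‖⁻¹ • w i) (‖w i‖⁻¹ • w i) = 1 := by
    rw [real_inner_self_eq_norm_sq, hunit, one_pow]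
  have hle := real_inner_le_norm (‖w i‖⁻¹ • w i) (‖w j‖⁻¹ • w j)
  rw [hunit, hunit] at hle
  rw [hq, hq, innerSL_apply_apply, innerSL_apply_apply]
  simp only [inner_neg_left, inner_sub_right] at hpos ⊢
  linarith
end

section
/- Let n ≥ 3 and let p : Fin n → EuclideanSpace ℝ 2 list the vertices of a strictly convex polygon in counterclockwise order, with indices taken modulo n; that is, for all i and j with j ≠ i and j ≠ i + 1, the cross product ((p (i+1)).1 − (p i).1) * ((p j).2 − (p i).2) − ((p (i+1)).2 − (p i).2) * ((p j).1 − (p i).1) is strictly positive (writing (·).1, (·).2 for the two coordinates). For each i set w i = ‖p (i+1) − p i‖⁻¹ • (p (i+1) − p i) + ‖p (i−1) − p i‖⁻¹ • (p (i−1) − p i) and q i = p i − ‖w i‖⁻¹ • (w i). Then the perimeter grows by at least 1: ∑ i, dist (q i) (q (i+1)) ≥ (∑ i, dist (p i) (p (i+1))) + 1. -/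
/-- The length of a closed chain dominates the distance between its initial point and any other. -/
theorem dist_le_sum_dist_cyclic {X : Type*} [PseudoMetricSpace X] {n : ℕ} [NeZero n]
    (u : Fin n → X) (j : Fin n) : dist (u 0) (u j) ≤ ∑ i, dist (u i) (u (i + 1)) := by
  have succ_eq (k : ℕ) : Fin.ofNat n (k + 1) = Fin.ofNat n k + 1 := by
    ext
    simp [Fin.val_add]
  have ofNat_val (i : Fin n) : Fin.ofNat n i.val = i := by
    ext
    simp
  have h0 : Fin.ofNat n 0 = 0 := by
    ext
    simp
  calc dist (u 0) (u j)
      ≤ ∑ k ∈ Finset.range j.val, dist (u (Fin.ofNat n k)) (u (Fin.ofNat n (k + 1))) := by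
        simpa only [h0, ofNat_val] using dist_le_range_sum_dist (fun k => u (Fin.ofNat n k)) j.val
    _ ≤ ∑ k ∈ Finset.range n, dist (u (Fin.ofNat n k)) (u (Fin.ofNat n (k + 1))) :=
        Finset.sum_le_sum_of_subset_of_nonneg (Finset.range_subset_range.2 j.isLt.le)
          fun _ _ _ => dist_nonneg
    _ = ∑ i, dist (u i) (u (i + 1)) := by
        rw [Finset.sum_range]
        refine Finset.sum_congr rfl fun i _ => ?_
        rw [succ_eq, ofNat_val]

/-- A closed chain of unit vectors that has a vanishing positive combination has length at
least one. -/
theorem one_le_sum_dist_of_sum_smul_eq_zero {E : Type*} [NormedAddCommGroup E]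
    [InnerProductSpace ℝ E] {n : ℕ} [NeZero n] (u : Fin n → E) (l : Fin n → ℝ)
    (hu : ∀ i, ‖u i‖ = 1) (hl : ∀ i, 0 < l i) (h : ∑ i, l i • u i = 0) :
    1 ≤ ∑ i, dist (u i) (u (i + 1)) := by
  obtain ⟨j, hj⟩ : ∃ j, inner ℝ (u j) (u 0) ≤ 0 := by
    by_contra! hpos
    have hsum : 0 < ∑ i, l i * inner ℝ (u i) (u 0) :=
      Finset.sum_pos (fun i _ => mul_pos (hl i) (hpos i)) Finset.univ_nonempty
    have hzero : inner ℝ (∑ i, l i • u i) (u 0) = 0 := by rw [h, inner_zero_left]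
    simp only [sum_inner, real_inner_smul_left] at hzero
    exact hsum.ne' hzero
  refine le_trans ?_ (dist_le_sum_dist_cyclic u j)
  have hsq := norm_sub_sq_real (u 0) (u j)
  rw [hu, hu, real_inner_comm] at hsq
  rw [dist_eq_norm]
  nlinarith [norm_nonneg (u 0 - u j)]

theorem perimeter_grows_by_one
    (n : ℕ) [NeZero n] (hn : 3 ≤ n)
    (p : Fin n → EuclideanSpace ℝ (Fin 2))
    (hconv : ∀ i j : Fin n, j ≠ i → j ≠ i + 1 →
      0 < (p (i + 1) 0 - p i 0) * (p j 1 - p i 1)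
          - (p (i + 1) 1 - p i 1) * (p j 0 - p i 0))
    (w : Fin n → EuclideanSpace ℝ (Fin 2))
    (hw : ∀ i, w i = ‖p (i + 1) - p i‖⁻¹ • (p (i + 1) - p i)
                     + ‖p (i - 1) - p i‖⁻¹ • (p (i - 1) - p i))
    (q : Fin n → EuclideanSpace ℝ (Fin 2))
    (hq : ∀ i, q i = p i - ‖w i‖⁻¹ • (w i)) :
    (∑ i, dist (p i) (p (i + 1))) + 1 ≤ ∑ i, dist (q i) (q (i + 1)) := by
  have hne (i : Fin n) : p (i + 1) - p i ≠ 0 := by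
    intro h
    obtain ⟨j, hj⟩ : ∃ j, j ∉ ({i, i + 1} : Finset (Fin n)) := by
      by_contra! hall
      have hcard := Finset.card_le_card (fun j _ => hall j : Finset.univ ⊆ {i, i + 1})
      rw [Finset.card_univ, Fintype.card_fin] at hcard
      have := Finset.card_le_two (a := i) (b := i + 1)
      omega
    simp only [Finset.mem_insert, Finset.mem_singleton, not_or] at hj
    have hc := hconv i j hj.1 hj.2
    rw [sub_eq_zero.1 h] at hc
    simp at hc
  set l : Fin n → ℝ := fun i => ‖p (i + 1) - p i‖
  set u : Fin n → EuclideanSpace ℝ (Fin 2) := fun i => (l i)⁻¹ • (p (i + 1) - p i) with hu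
  have hlpos (i) : 0 < l i := norm_pos_iff.2 (hne i)
  have hunorm (i) : ‖u i‖ = 1 := by
    rw [hu, norm_smul, norm_inv, Real.norm_of_nonneg (hlpos i).le]
    exact inv_mul_cancel₀ (hlpos i).ne'
  have hlu (i) : l i • u i = p (i + 1) - p i := smul_inv_smul₀ (hlpos i).ne' _
  have shift {M : Type} [AddCommMonoid M] (f : Fin n → M) : ∑ i, f (i + 1) = ∑ i, f i :=
    Equiv.sum_comp (Equiv.addRight (1 : Fin n)) f
  have hclosed : ∑ i, l i • u i = 0 := by
    simp only [hlu, Finset.sum_sub_distrib, shift p, sub_self]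
  have hwu (i) : w (i + 1) = u (i + 1) - u i := by
    rw [hw, add_sub_cancel_right, norm_sub_rev (p i), ← neg_sub (p (i + 1)) (p i), smul_neg,
      ← sub_eq_add_neg]
  set e : Fin n → EuclideanSpace ℝ (Fin 2) := fun i => ‖w i‖⁻¹ • w i with he
  have hinner (i) : inner ℝ (e i) (w i) = ‖w i‖ := by
    rw [he, real_inner_smul_left, real_inner_self_eq_norm_sq]
    rcases eq_or_ne ‖w i‖ 0 with h | h
    · simp [h]
    · field_simp
  have hstep (i) : l i + (inner ℝ (e i) (u i) - inner ℝ (e (i + 1)) (u i))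
      ≤ dist (q i) (q (i + 1)) := by
    have hcs := real_inner_le_norm (q (i + 1) - q i) (u i)
    have hq' : q (i + 1) - q i = l i • u i + (e i - e (i + 1)) := by
      rw [hlu, hq, hq]
      abel
    rw [hunorm, mul_one, ← dist_eq_norm, dist_comm, hq', inner_add_left, inner_sub_left,
      real_inner_smul_left, real_inner_self_eq_norm_sq, hunorm] at hcs
    linarith
  have hgain : ∑ i, (inner ℝ (e i) (u i) - inner ℝ (e (i + 1)) (u i))
      = ∑ i, dist (u i) (u (i + 1)) := by
    rw [Finset.sum_sub_distrib, ← shift (fun i => inner ℝ (e i) (u i)),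
      ← Finset.sum_sub_distrib]
    refine Finset.sum_congr rfl fun i _ => ?_
    rw [← inner_sub_right, ← hwu, hinner, hwu, dist_comm, dist_eq_norm]
  calc (∑ i, dist (p i) (p (i + 1))) + 1
      ≤ ∑ i, l i + ∑ i, dist (u i) (u (i + 1)) := by
        have hdist (i) : dist (p i) (p (i + 1)) = l i := by rw [dist_comm, dist_eq_norm]
        simp only [hdist]
        gcongr
        exact one_le_sum_dist_of_sum_smul_eq_zero u l hunorm hlpos hclosed
    _ = ∑ i, (l i + (inner ℝ (e i) (u i) - inner ℝ (e (i + 1)) (u i))) := by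
        rw [Finset.sum_add_distrib, hgain]
    _ ≤ ∑ i, dist (q i) (q (i + 1)) := Finset.sum_le_sum fun i _ => hstep i
end
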